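/- arXiv:1801.06974 — 2 statements merged into one kernel-verified Lean document; each statement's English description precedes it below -/
import Mathlib

section
/- Let A be a torsion-free abelian group and let G be a group acting on A by group automorphisms such that every orbit of the action is finite. Suppose that the fixed-point algebra C(Â)^G — the star-subalgebra of G-invariant functions in the algebra C(Â, ℂ) of continuous complex-valued functions on the Pontryagin dual Â, where G acts on Â by precomposition with the inverse action and hence on C(Â, ℂ) — is isomorphic as a star-algebra to C(T^n, ℂ) for some n ∈ ℕ (equivalently, by Gelfand duality, the orbit space Â/G is homeomorphic to T^n). Then A is isomorphic as a group to ℤ^n and G acts trivially on A. -/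
/-- The star-subalgebra of `C(X, ℂ)` consisting of the functions invariant under a
(set-theoretic) action `act : G → X → X`. -/
noncomputable def fixedFunctions {G X : Type*} [TopologicalSpace X] (act : G → X → X) :
    StarSubalgebra ℂ C(X, ℂ) where
  carrier := {f : C(X, ℂ) | ∀ (g : G) (x : X), f (act g x) = f x}
  mul_mem' {a b} ha hb g x := by simp [ha g x, hb g x]
  add_mem' {a b} ha hb g x := by simp [ha g x, hb g x]
  one_mem' g x := by simp
  zero_mem' g x := by simp
  algebraMap_mem' r g x := by simp
  star_mem' {a} ha g x := by simp [ha g x]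

open MeasureTheory Set Topology

open Polynomial in
/-- The polynomial in `t` with continuous coefficients, whose value at `t` is
`p (x + t v x) * det (1 + t Dv x)`. -/
lemma exists_polynomial_comp_mul_det {k : ℕ} (v : (Fin k → ℝ) → (Fin k → ℝ))
    (hv : ContDiff ℝ 1 v) (p : MvPolynomial (Fin k) ℝ) :
    ∃ q : C(Fin k → ℝ, ℝ)[X], ∀ (t : ℝ) (x : Fin k → ℝ),
      MvPolynomial.eval (x + t • v x) p *
        (ContinuousLinearMap.id ℝ (Fin k → ℝ) + t • fderiv ℝ v x).det =
      ∑ i ∈ q.support, t ^ i * q.coeff i x := by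
  classical
  have hD : Continuous (fderiv ℝ v) := hv.continuous_fderiv (by simp)
  let V (i : Fin k) : C(Fin k → ℝ, ℝ) := ⟨fun x => v x i, by have := hv.continuous; fun_prop⟩
  let I (i : Fin k) : C(Fin k → ℝ, ℝ) := ⟨fun x => x i, by fun_prop⟩
  let D (i j : Fin k) : C(Fin k → ℝ, ℝ) :=
    ⟨fun x => fderiv ℝ v x (Pi.single j 1) i, by fun_prop⟩
  let P : C(Fin k → ℝ, ℝ)[X] := MvPolynomial.aeval (fun i => C (I i) + X * C (V i)) p
  let M : Matrix (Fin k) (Fin k) C(Fin k → ℝ, ℝ)[X] := 1 + Matrix.of fun i j => X * C (D i j)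
  refine ⟨P * M.det, fun t x => ?_⟩
  let ev : C(Fin k → ℝ, ℝ)[X] →+* ℝ :=
    Polynomial.eval₂RingHom (ContinuousMap.evalAlgHom ℝ ℝ x).toRingHom t
  have hev : ∀ q : C(Fin k → ℝ, ℝ)[X], ev q = ∑ i ∈ q.support, t ^ i * q.coeff i x := by
    intro q
    simp only [ev, coe_eval₂RingHom, eval₂_eq_sum, Polynomial.sum]
    exact Finset.sum_congr rfl fun i _ => mul_comm _ _
  have hC (c : C(Fin k → ℝ, ℝ)) : ev (C c) = c x := by simp [ev]
  have hX : ev X = t := by simp [ev]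
  rw [← hev, map_mul]
  congr 1
  · have : (ev.comp (algebraMap ℝ C(Fin k → ℝ, ℝ)[X])) = RingHom.id ℝ := Subsingleton.elim _ _
    simp only [P]
    rw [MvPolynomial.aeval_def, MvPolynomial.hom_eval₂, this]
    simp only [map_add, map_mul, hC, hX]
    rw [MvPolynomial.eval₂_id]
    rfl
  · rw [RingHom.map_det, ContinuousLinearMap.det, ← LinearMap.det_toMatrix']
    congr 1
    ext i j
    by_cases hij : i = j <;>
      simp [M, LinearMap.toMatrix'_apply, hC, hX, D, hij] <;> ring

lemma bijOn_id_add_smul {E : Type*} [NormedAddCommGroup E] [NormedSpace ℝ E] [CompleteSpace E]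
    {v : E → E} {c : NNReal} (hc : LipschitzWith c v) {Q : Set E} (hQ : ∀ x ∉ Q, v x = 0)
    {t : ℝ} (ht : ‖t‖₊ * c < 1) : BijOn (fun x => x + t • v x) Q Q := by
  have hL (y : E) : ContractingWith (‖t‖₊ * c) (fun x => y - t • v x) := by
    refine ⟨ht, LipschitzWith.of_dist_le_mul fun a b => ?_⟩
    have := hc.dist_le_mul a b
    rw [dist_sub_left, dist_smul₀]
    push_cast
    rw [mul_assoc]
    gcongr
  have hinj : Function.Injective (fun x => x + t • v x) := by
    intro a b hab
    have hab : a + t • v a = b + t • v b := hab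
    refine (hL (a + t • v a)).fixedPoint_unique' (x := a) (y := b) ?_ ?_
    · simp [Function.IsFixedPt]
    · simp [Function.IsFixedPt, hab]
  refine ⟨fun x hx => ?_, hinj.injOn, fun y hy => ?_⟩
  · by_contra hy
    have : x + t • v x = x := hinj (by simp [hQ _ hy])
    exact hy (by simpa [this] using hx)
  · have hfix := (hL y).fixedPoint_isFixedPt
    set x := ContractingWith.fixedPoint _ (hL y) with hxdef
    have hxy : x + t • v x = y := by
      rw [Function.IsFixedPt] at hfix
      nth_rewrite 1 [← hfix]
      simp
    refine ⟨x, ?_, hxy⟩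
    by_contra hx
    rw [hQ x hx] at hxy
    simp only [smul_zero, add_zero] at hxy
    exact hx (hxy ▸ hy)

open Polynomial in
lemma setIntegral_eval_add_mul_det {k : ℕ} {v : (Fin k → ℝ) → (Fin k → ℝ)}
    (hv : ContDiff ℝ 1 v) (hs : HasCompactSupport v) {Q : Set (Fin k → ℝ)} (hQc : IsCompact Q)
    (hQ : ∀ x ∉ Q, v x = 0) (p : MvPolynomial (Fin k) ℝ) :
    ∫ x in Q, MvPolynomial.eval (x + v x) p *
        (ContinuousLinearMap.id ℝ (Fin k → ℝ) + fderiv ℝ v x).det =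
      ∫ x in Q, MvPolynomial.eval x p := by
  obtain ⟨q, hq⟩ := exists_polynomial_comp_mul_det v hv p
  obtain ⟨c, hc⟩ := hv.lipschitzWith_of_hasCompactSupport hs one_ne_zero
  let r : ℝ[X] := ∑ i ∈ q.support, monomial i (∫ x in Q, q.coeff i x)
  have hr (t : ℝ) : r.eval t = ∫ x in Q, MvPolynomial.eval (x + t • v x) p *
        (ContinuousLinearMap.id ℝ (Fin k → ℝ) + t • fderiv ℝ v x).det := by
    simp_rw [hq]
    rw [integral_finsetSum]
    · simp only [r, eval_finsetSum, eval_monomial, integral_const_mul]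
      exact Finset.sum_congr rfl fun i _ => mul_comm _ _
    · intro i _
      exact ((q.coeff i).continuous.continuousOn.integrableOn_compact hQc).const_mul _
  have hdet : ∀ᶠ L in 𝓝 (ContinuousLinearMap.id ℝ (Fin k → ℝ)), 0 < L.det := by
    refine (ContinuousLinearMap.continuous_det.tendsto _).eventually (lt_mem_nhds ?_)
    rw [ContinuousLinearMap.det, ContinuousLinearMap.coe_id, LinearMap.det_id]
    exact one_pos
  obtain ⟨ε, hε, hdet⟩ := Metric.eventually_nhds_iff.1 hdet
  have hsmall : ∀ᶠ t in 𝓝 (0 : ℝ), r.eval t = ∫ x in Q, MvPolynomial.eval x p := by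
    have h1 : ∀ᶠ t in 𝓝 (0 : ℝ), ‖t‖₊ * c < 1 := by
      have : Continuous fun t : ℝ => ‖t‖₊ * c := by fun_prop
      exact (this.tendsto 0).eventually (gt_mem_nhds (by simp))
    have h2 : ∀ᶠ t in 𝓝 (0 : ℝ), ‖t‖ * c < ε := by
      have : Continuous fun t : ℝ => ‖t‖ * c := by fun_prop
      exact (this.tendsto 0).eventually (gt_mem_nhds (by simpa))
    filter_upwards [h1, h2] with t h1 h2
    have hb := bijOn_id_add_smul hc hQ h1
    have := integral_image_eq_integral_abs_det_fderiv_smul volume hQc.measurableSet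
      (f := fun x => x + t • v x)
      (f' := fun x => ContinuousLinearMap.id ℝ (Fin k → ℝ) + t • fderiv ℝ v x)
      (fun x _ => ((hasFDerivAt_id x).add
        (((hv.differentiable one_ne_zero) x).hasFDerivAt.const_smul t)).hasFDerivWithinAt)
      hb.injOn (fun y => MvPolynomial.eval y p)
    rw [hb.image_eq] at this
    rw [hr, this]
    congr 1
    ext x
    rw [abs_of_pos, smul_eq_mul, mul_comm]
    apply hdet
    rw [dist_eq_norm, add_sub_cancel_left, norm_smul]
    refine lt_of_le_of_lt ?_ h2
    gcongr
    exact norm_fderiv_le_of_lipschitz ℝ hc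
  have : r = C (∫ x in Q, MvPolynomial.eval x p) := by
    apply Polynomial.eq_of_infinite_eval_eq
    refine (infinite_of_mem_nhds (0 : ℝ) hsmall).mono fun t ht => ?_
    simpa using ht
  have h1 := hr 1
  rw [this] at h1
  simpa using h1.symm

lemma exists_mvPolynomial_near {k : ℕ} {K : Set (Fin k → ℝ)} (hK : IsCompact K)
    (φ : (Fin k → ℝ) → ℝ) (hφ : Continuous φ) {ε : ℝ} (hε : 0 < ε) :
    ∃ p : MvPolynomial (Fin k) ℝ, ∀ x ∈ K, |MvPolynomial.eval x p - φ x| < ε := by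
  have : CompactSpace K := isCompact_iff_compactSpace.1 hK
  let I (i : Fin k) : C(K, ℝ) := ⟨fun x => x.1 i, (continuous_apply i).comp continuous_subtype_val⟩
  let a : MvPolynomial (Fin k) ℝ →ₐ[ℝ] C(K, ℝ) := MvPolynomial.aeval I
  have hsep : a.range.SeparatesPoints := by
    intro x y hxy
    obtain ⟨i, hi⟩ := Function.ne_iff.1 (Subtype.coe_injective.ne hxy)
    exact ⟨_, ⟨I i, ⟨MvPolynomial.X i, by simp [a]⟩, rfl⟩, hi⟩
  obtain ⟨⟨_, p, rfl⟩, hp⟩ :=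
    ContinuousMap.exists_mem_subalgebra_near_continuousMap_of_separatesPoints
    a.range hsep ⟨fun x => φ x, by fun_prop⟩ ε hε
  refine ⟨p, fun x hx => ?_⟩
  have h := (ContinuousMap.norm_lt_iff _ hε).1 hp ⟨x, hx⟩
  have hev : (a p) ⟨x, hx⟩ = MvPolynomial.eval x p := by
    have : (ContinuousMap.evalAlgHom ℝ ℝ (⟨x, hx⟩ : K)).comp a = MvPolynomial.aeval x :=
      MvPolynomial.algHom_ext fun i => by simp [a, I]
    rw [← MvPolynomial.coe_aeval_eq_eval]
    exact DFunLike.congr_fun this p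
  simpa [hev] using h

/-- A `C¹` compactly supported perturbation of the identity of `ℝᵏ` has a zero. -/
lemma exists_add_eq_zero_of_contDiff {k : ℕ} {v : (Fin k → ℝ) → (Fin k → ℝ)}
    (hv : ContDiff ℝ 1 v) (hs : HasCompactSupport v) : ∃ x, x + v x = 0 := by
  by_contra! hne
  obtain ⟨R, hR, hRv⟩ := hs.isCompact.isBounded.subset_closedBall_lt 0 0
  set Q := Metric.closedBall (0 : Fin k → ℝ) R with hQdef
  have hQc : IsCompact Q := isCompact_closedBall _ _
  have hQ : ∀ x ∉ Q, v x = 0 := fun x hx => by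
    by_contra h
    exact hx (hRv (subset_tsupport _ h))
  have hvc := hv.continuous
  have hcont : Continuous fun x => x + v x := by fun_prop
  have hdetc : Continuous fun x =>
      (ContinuousLinearMap.id ℝ (Fin k → ℝ) + fderiv ℝ v x).det := by
    have hD : Continuous (fderiv ℝ v) := hv.continuous_fderiv (by simp)
    exact ContinuousLinearMap.continuous_det.comp (by fun_prop)
  have hQ' : IsCompact ((fun x => x + v x) '' Q) := hQc.image hcont
  obtain ⟨δ, hδ, hball⟩ := Metric.isOpen_iff.1 hQ'.isClosed.isOpen_compl 0
    (by rintro ⟨x, -, hx⟩; exact hne x hx)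
  let φ : (Fin k → ℝ) → ℝ := fun y => max 0 (δ - ‖y‖)
  have hφ : Continuous φ := by fun_prop
  have hφh : ∀ x ∈ Q, φ (x + v x) = 0 := by
    intro x hx
    refine max_eq_left ?_
    by_contra! h
    exact hball (mem_ball_zero_iff.2 (sub_pos.1 h)) ⟨x, hx, rfl⟩
  have hφpos : 0 < ∫ x in Q, φ x := by
    rw [setIntegral_pos_iff_support_of_nonneg_ae 
      (f := φ) (Filter.Eventually.of_forall fun x => le_max_left _ _)
      (hφ.continuousOn.integrableOn_compact hQc)]
    refine lt_of_lt_of_le (Metric.measure_ball_pos volume (0 : Fin k → ℝ) (lt_min hδ hR))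
      (measure_mono fun x hx => ?_)
    rw [mem_ball_zero_iff, lt_min_iff] at hx
    refine ⟨?_, mem_closedBall_zero_iff.2 hx.2.le⟩
    exact (lt_max_of_lt_right (sub_pos.2 hx.1)).ne'
  set D := ∫ x in Q, |(ContinuousLinearMap.id ℝ (Fin k → ℝ) + fderiv ℝ v x).det| with hD
  have hD0 : 0 ≤ D := integral_nonneg fun _ => abs_nonneg _
  set V := volume.real Q with hV
  have hV0 : 0 ≤ V := measureReal_nonneg
  set η := (∫ x in Q, φ x) / (V + D + 1) with hη
  have hη0 : 0 < η := by positivity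
  obtain ⟨p, hp⟩ := exists_mvPolynomial_near (hQc.union hQ') φ hφ hη0
  have hpc : Continuous fun x => MvPolynomial.eval x p := MvPolynomial.continuous_eval p
  have h1 : |∫ x in Q, (MvPolynomial.eval x p - φ x)| ≤ η * V := by
    rw [← Real.norm_eq_abs]
    refine norm_setIntegral_le_of_norm_le_const hQc.measure_lt_top fun x hx => ?_
    exact (hp x (Or.inl hx)).le
  have h2 : |∫ x in Q, MvPolynomial.eval (x + v x) p *
        (ContinuousLinearMap.id ℝ (Fin k → ℝ) + fderiv ℝ v x).det| ≤ η * D := by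
    rw [← Real.norm_eq_abs, hD, ← integral_const_mul]
    refine norm_integral_le_of_norm_le ?_ ?_
    · exact ((hdetc.abs.const_mul η).continuousOn.integrableOn_compact hQc)
    · refine (ae_restrict_mem hQc.measurableSet).mono fun x hx => ?_
      rw [norm_mul, Real.norm_eq_abs, Real.norm_eq_abs]
      gcongr
      have := hp _ (Or.inr ⟨x, hx, rfl⟩)
      simp only [hφh x hx, sub_zero] at this
      exact this.le
  rw [setIntegral_eval_add_mul_det hv hs hQc hQ p] at h2
  rw [integral_sub (hpc.continuousOn.integrableOn_compact hQc)
    (hφ.continuousOn.integrableOn_compact hQc)] at h1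
  have h3 : η * (V + D + 1) = ∫ x in Q, φ x := by
    rw [hη]; field_simp
  have := abs_le.1 h1
  have := abs_le.1 h2
  nlinarith

/-- A continuous map on a ball of `ℝᵏ` that moves points by less than the radius has a zero. -/
lemma exists_eq_zero_of_norm_sub_lt {k : ℕ} {h : (Fin k → ℝ) → (Fin k → ℝ)} (hh : Continuous h)
    {r : ℝ} (hr : 0 < r) (hlt : ∀ x ∈ Metric.closedBall 0 r, ‖h x - x‖ < r) :
    ∃ x ∈ Metric.closedBall (0 : Fin k → ℝ) r, h x = 0 := by
  by_contra! hne
  have hcB := isCompact_closedBall (0 : Fin k → ℝ) r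
  have hB0 : (0 : Fin k → ℝ) ∈ Metric.closedBall 0 r := Metric.mem_closedBall_self hr.le
  obtain ⟨x₀, hx₀, hmax⟩ := hcB.exists_isMaxOn ⟨0, hB0⟩
    (f := fun x => ‖h x - x‖) (by fun_prop)
  set M := ‖h x₀ - x₀‖ with hM
  have hMr : M < r := hlt x₀ hx₀
  have hM0 : 0 ≤ M := norm_nonneg _
  let ψ : (Fin k → ℝ) → ℝ := fun x => min 1 (max 0 ((r - ‖x‖) / (r - M)))
  have hψ0 (x) : 0 ≤ ψ x := le_min zero_le_one (le_max_left _ _)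
  have hψ1 (x) : ψ x ≤ 1 := min_le_left _ _
  have hψin (x) (hx : ‖x‖ ≤ M) : ψ x = 1 := by
    refine min_eq_left (le_max_of_le_right ?_)
    rw [one_le_div (by linarith)]
    linarith
  have hψout (x) (hx : r ≤ ‖x‖) : ψ x = 0 := by
    have : (r - ‖x‖) / (r - M) ≤ 0 := div_nonpos_of_nonpos_of_nonneg (by linarith) (by linarith)
    simp [ψ, max_eq_left this]
  have hψc : Continuous ψ := by fun_prop
  let u : (Fin k → ℝ) → (Fin k → ℝ) := fun x => ψ x • (h x - x)
  have huc : Continuous u := by fun_prop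
  have hu0 (x) (hx : r ≤ ‖x‖) : u x = 0 := by simp [u, hψout x hx]
  have hsupp : Function.support u ⊆ Metric.closedBall 0 r := fun x hx => by
    rw [mem_closedBall_zero_iff]
    by_contra! hlt
    exact hx (hu0 x hlt.le)
  have hne' (x) : x + u x ≠ 0 := by
    intro h0
    rcases le_or_gt ‖x‖ M with hx | hx
    · refine hne x (mem_closedBall_zero_iff.2 (hx.trans hMr.le)) ?_
      simpa [u, hψin x hx] using h0
    · have hxu : ‖x‖ = ‖u x‖ := by
        rw [← norm_neg (u x), ← eq_neg_of_add_eq_zero_left h0]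
      rcases le_or_gt r ‖x‖ with hxr | hxr
      · rw [hu0 x hxr, norm_zero] at hxu
        linarith
      · have h1 : ‖h x - x‖ ≤ M := hmax (mem_closedBall_zero_iff.2 hxr.le)
        have h2 : ‖u x‖ ≤ 1 * M := by
          rw [norm_smul, Real.norm_of_nonneg (hψ0 x)]
          exact mul_le_mul (hψ1 x) h1 (norm_nonneg _) zero_le_one
        linarith
  obtain ⟨x₁, -, hmin⟩ := hcB.exists_isMinOn ⟨0, hB0⟩ (f := fun x => ‖x + u x‖) (by fun_prop)
  have hδ : 0 < min r ‖x₁ + u x₁‖ := lt_min hr (norm_pos_iff.2 (hne' x₁))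
  have hbound (x) : min r ‖x₁ + u x₁‖ ≤ ‖x + u x‖ := by
    rcases le_or_gt ‖x‖ r with hx | hx
    · exact (min_le_right _ _).trans (hmin (mem_closedBall_zero_iff.2 hx))
    · rw [hu0 x hx.le, add_zero]
      exact (min_le_left _ _).trans hx.le
  obtain ⟨v, hv, hvu, hvs⟩ := huc.exists_contDiff_approx 1
    (ε := fun _ => min r ‖x₁ + u x₁‖) continuous_const (fun _ => hδ)
  obtain ⟨x, hx⟩ := exists_add_eq_zero_of_contDiff (mod_cast hv)
    (HasCompactSupport.of_support_subset_isCompact hcB (hvs.trans hsupp))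
  have h1 := hvu x
  rw [eq_neg_of_add_eq_zero_right hx, dist_eq_norm, ← neg_add', norm_neg] at h1
  exact absurd (hbound x) h1.not_ge

/-- A continuous map `ℝᵏ → ℝⁿ` which is injective on a ball exists only for `k ≤ n`. -/
lemma le_of_continuous_injOn_closedBall {k n : ℕ} {j : (Fin k → ℝ) → (Fin n → ℝ)}
    (hj : Continuous j) {r : ℝ} (hr : 0 < r) (hinj : InjOn j (Metric.closedBall 0 r)) :
    k ≤ n := by
  by_contra! hnk
  have : CompactSpace (Metric.closedBall (0 : Fin k → ℝ) r) :=
    isCompact_iff_compactSpace.1 (isCompact_closedBall _ _)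
  have hemb : Topology.IsClosedEmbedding fun x : Metric.closedBall (0 : Fin k → ℝ) r => j x :=
    Continuous.isClosedEmbedding (by fun_prop) fun x y hxy => Subtype.ext (hinj x.2 y.2 hxy)
  obtain ⟨F, hF⟩ := ContinuousMap.exists_extension' hemb
    (⟨fun x => x.1, continuous_subtype_val⟩ : C(Metric.closedBall (0 : Fin k → ℝ) r, Fin k → ℝ))
  obtain ⟨F', hF', hFF', -⟩ := F.continuous.exists_contDiff_approx 1
    (ε := fun _ => r / 2) continuous_const (fun _ => half_pos hr)
  obtain ⟨c, hc, hcr⟩ := Metric.dense_iff.1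
    (ContDiff.dense_compl_range_of_finrank_lt_finrank (mod_cast hF') (by simpa using hnk)) 0
    (r / 2) (half_pos hr)
  have hF'c := hF'.continuous
  obtain ⟨x, -, hx⟩ := exists_eq_zero_of_norm_sub_lt (h := fun x => F' (j x) - c) (by fun_prop) hr
    fun x hx => by
      have h1 : F (j x) = x := congrFun hF ⟨x, hx⟩
      have h2 := hFF' (j x)
      rw [h1, dist_eq_norm] at h2
      rw [mem_ball_zero_iff] at hc
      calc ‖F' (j x) - c - x‖ = ‖(F' (j x) - x) - c‖ := by congr 1; abel
        _ ≤ ‖F' (j x) - x‖ + ‖c‖ := norm_sub_le _ _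
        _ < r := by linarith
  exact hcr ⟨j x, sub_eq_zero.1 hx⟩

/-- A continuous map `ℝᵏ → Tⁿ` which is injective on a ball exists only for `k ≤ n`. -/
lemma le_of_continuous_injOn_closedBall_torus {k n : ℕ}
    {j : (Fin k → ℝ) → (Fin n → AddCircle (1 : ℝ))}
    (hj : Continuous j) {r : ℝ} (hr : 0 < r) (hinj : InjOn j (Metric.closedBall 0 r)) :
    k ≤ n := by
  have hlift (i : Fin n) : ∃ f : C(Fin k → ℝ, ℝ), ∀ x, (f x : AddCircle (1 : ℝ)) = j x i := by
    obtain ⟨e, he⟩ := QuotientAddGroup.mk_surjective (j 0 i)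
    obtain ⟨f, ⟨-, hf⟩, -⟩ := (AddCircle.isCoveringMap_coe (1 : ℝ)).existsUnique_continuousMap_lifts
      (⟨fun x => j x i, by fun_prop⟩ : C(Fin k → ℝ, AddCircle (1 : ℝ))) (a₀ := 0) (e₀ := e) he
    exact ⟨f, fun x => congrFun hf x⟩
  choose f hf using hlift
  refine le_of_continuous_injOn_closedBall (j := fun x i => f i x) (by fun_prop) hr
    fun x hx y hy hxy => hinj hx hy ?_
  ext i
  rw [← hf, ← hf]
  exact congrArg _ (congrFun hxy i)

/-- Two continuous logarithms of the same function on a connected space, which agree at a point,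
are equal. -/
lemma eq_of_exp_comp_eq {X : Type*} [TopologicalSpace X] [PreconnectedSpace X] {f g : X → ℂ}
    (hf : Continuous f) (hg : Continuous g) (h : ∀ x, Complex.exp (f x) = Complex.exp (g x))
    (a : X) (ha : f a = g a) : f = g :=
  Complex.isCoveringMap_exp.eq_of_comp_eq hf hg (funext fun x => Subtype.ext (h x)) a ha

lemma eq_zero_of_exp_mul_eq_exp_bounded {w : ℝ → ℂ} (hw : Continuous w) {C : ℝ}
    (hC : ∀ x, ‖w x‖ ≤ C) {c : ℝ}
    (h : ∀ x : ℝ, Complex.exp (2 * Real.pi * Complex.I * c * x) = Complex.exp (w x)) : c = 0 := by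
  have hpi := Real.pi_pos
  by_contra hc
  have h0 : Complex.exp (w 0) = 1 := by rw [← h]; simp
  have heq := eq_of_exp_comp_eq (f := fun x : ℝ => 2 * Real.pi * Complex.I * c * x + w 0)
    (g := w) (by fun_prop) hw (fun x => by rw [Complex.exp_add, h, h0, mul_one]) 0 (by simp)
  have hbd (x : ℝ) : 2 * Real.pi * |c| * |x| ≤ C + C := by
    have h1 := congrFun heq x
    have h2 : (2 * Real.pi * Complex.I * c * x : ℂ) = w x - w 0 := by rw [← h1]; ring
    have h3 := norm_sub_le (w x) (w 0)
    rw [← h2] at h3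
    have h4 := hC x
    have h5 := hC 0
    have h6 : ‖(2 * Real.pi * Complex.I * c * x : ℂ)‖ = 2 * Real.pi * |c| * |x| := by
      simp [abs_of_pos hpi]
    linarith
  have hpos : 0 < 2 * Real.pi * |c| := by positivity
  have h1 := hbd ((C + C + 1) / (2 * Real.pi * |c|))
  have h2 := mul_le_mul_of_nonneg_left (le_abs_self ((C + C + 1) / (2 * Real.pi * |c|))) hpos.le
  rw [mul_div_cancel₀ _ hpos.ne'] at h2
  linarith

/-- The covering projection `ℝⁿ → Tⁿ`. -/
noncomputable def torusMk {n : ℕ} : C(Fin n → ℝ, Fin n → AddCircle (1 : ℝ)) where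
  toFun x i := (x i : AddCircle (1 : ℝ))
  continuous_toFun := continuous_pi fun i => (AddCircle.continuous_mk' 1).comp (continuous_apply i)

lemma torusMk_apply {n : ℕ} (x : Fin n → ℝ) (i : Fin n) :
    torusMk x i = (x i : AddCircle (1 : ℝ)) := rfl

lemma isOpenQuotientMap_torusMk {n : ℕ} : IsOpenQuotientMap (torusMk (n := n)) :=
  IsOpenQuotientMap.piMap fun _ => QuotientAddGroup.isOpenQuotientMap_mk

lemma torusMk_eq_torusMk_iff {n : ℕ} {x y : Fin n → ℝ} :
    torusMk x = torusMk y ↔ ∃ m : Fin n → ℤ, y = x + fun i => (m i : ℝ) := by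
  simp only [funext_iff, torusMk_apply, Pi.add_apply]
  rw [← Classical.skolem (p := fun i (m : ℤ) => y i = x i + m)]
  refine forall_congr' fun i => ?_
  rw [eq_comm, ← sub_eq_zero, ← AddCircle.coe_sub, AddCircle.coe_eq_zero_iff]
  refine exists_congr fun m => ?_
  rw [zsmul_eq_mul, mul_one, eq_comm, sub_eq_iff_eq_add']

/-- A `ℤⁿ`-periodic continuous function on `ℝⁿ` descends to the torus. -/
lemma exists_comp_torusMk_eq {n : ℕ} {w : (Fin n → ℝ) → ℂ} (hw : Continuous w)
    (h : ∀ (x : Fin n → ℝ) (m : Fin n → ℤ), w (x + fun i => (m i : ℝ)) = w x) :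
    ∃ W : C(Fin n → AddCircle (1 : ℝ), ℂ), ∀ x, W (torusMk x) = w x := by
  have hfac : Function.FactorsThrough (⟨w, hw⟩ : C(Fin n → ℝ, ℂ)) torusMk := by
    intro x y hxy
    obtain ⟨m, rfl⟩ := torusMk_eq_torusMk_iff.1 hxy
    exact (h x m).symm
  exact ⟨isOpenQuotientMap_torusMk.isQuotientMap.lift _ hfac,
    DFunLike.congr_fun (isOpenQuotientMap_torusMk.isQuotientMap.lift_comp _ hfac)⟩

lemma mFourier_torusMk {n : ℕ} (c : Fin n → ℤ) (x : Fin n → ℝ) :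
    UnitAddTorus.mFourier c (torusMk x) =
      Complex.exp (2 * Real.pi * Complex.I * ∑ i, (c i : ℂ) * x i) := by
  simp only [UnitAddTorus.mFourier, torusMk_apply, ContinuousMap.coe_mk, fourier_coe_apply]
  rw [← Complex.exp_sum, Finset.mul_sum]
  congr 1
  refine Finset.sum_congr rfl fun i _ => ?_
  push_cast
  ring

lemma exists_log_comp {n : ℕ} {f : (Fin n → ℝ) → ℂ} (hf : Continuous f) (h0 : ∀ x, f x ≠ 0) :
    ∃ θ : (Fin n → ℝ) → ℂ, Continuous θ ∧ ∀ x, Complex.exp (θ x) = f x := by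
  obtain ⟨θ, ⟨-, hθ⟩, -⟩ := Complex.isCoveringMapOn_exp.existsUnique_continuousMap_lifts
    ⟨f, hf⟩ (Complex.exp_log (h0 0)) h0
  exact ⟨θ, θ.continuous, congrFun hθ⟩

/-- Every nowhere vanishing continuous function on the torus is a monomial times an
exponential. -/
lemma exists_eq_mFourier_mul_exp {n : ℕ} (F : C(Fin n → AddCircle (1 : ℝ), ℂ))
    (hF : ∀ t, F t ≠ 0) :
    ∃ (c : Fin n → ℤ) (W : C(Fin n → AddCircle (1 : ℝ), ℂ)),
      ∀ t, F t = UnitAddTorus.mFourier c t * Complex.exp (W t) := by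
  obtain ⟨θ, hθ, he⟩ := exists_log_comp (f := fun x => F (torusMk x)) (by fun_prop)
    (fun x => hF _)
  have hper (x) (m : Fin n → ℤ) : torusMk (x + fun i => (m i : ℝ)) = torusMk x :=
    (torusMk_eq_torusMk_iff.2 ⟨m, rfl⟩).symm
  have hc (m : Fin n → ℤ) : ∃ c : ℤ,
      ∀ x, θ (x + fun i => (m i : ℝ)) = θ x + c * (2 * Real.pi * Complex.I) := by
    obtain ⟨c, hc⟩ := Complex.exp_eq_exp_iff_exists_int.1
      ((he (0 + fun i => (m i : ℝ))).trans ((congrArg F (hper 0 m)).trans (he 0).symm))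
    refine ⟨c, congrFun (eq_of_exp_comp_eq (f := fun x => θ (x + fun i => (m i : ℝ)))
      (g := fun x => θ x + c * (2 * Real.pi * Complex.I))
      (by fun_prop) (by fun_prop) (fun x => ?_) 0 hc)⟩
    rw [he, hper, Complex.exp_add, he, Complex.exp_int_mul_two_pi_mul_I, mul_one]
  choose κ hκ using hc
  have hκ0 (m) : θ (fun i => (m i : ℝ)) = θ 0 + κ m * (2 * Real.pi * Complex.I) := by
    simpa using hκ m 0
  have hadd (m m') : κ (m + m') = κ m + κ m' := by
    have h1 := hκ m (fun i => (m' i : ℝ))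
    have h2 := hκ0 (m + m')
    have h3 : (fun i => (((m + m') i : ℤ) : ℝ)) = (fun i => (m' i : ℝ)) + fun i => (m i : ℝ) := by
      ext i; simp [add_comm]
    rw [h3, h1, hκ0 m'] at h2
    have h4 : ((κ (m + m') : ℂ) - (κ m + κ m')) * (2 * Real.pi * Complex.I) = 0 := by
      linear_combination -h2
    have h5 := (mul_eq_zero.1 h4).resolve_right Complex.two_pi_I_ne_zero
    exact_mod_cast sub_eq_zero.1 h5
  let K : (Fin n → ℤ) →+ ℤ := AddMonoidHom.mk' κ hadd
  let c : Fin n → ℤ := fun i => K (Pi.single i 1)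
  have hK (m) : κ m = ∑ i, c i * m i := by
    change K m = _
    conv_lhs => rw [← Finset.univ_sum_single m, map_sum]
    refine Finset.sum_congr rfl fun i _ => ?_
    have : Pi.single i (m i) = m i • (Pi.single i 1 : Fin n → ℤ) := by
      rw [← Pi.single_smul]; simp
    rw [this, map_zsmul, smul_eq_mul, mul_comm]
  obtain ⟨W, hW⟩ := exists_comp_torusMk_eq
    (w := fun x => θ x - 2 * Real.pi * Complex.I * ∑ i, (c i : ℂ) * x i) (by fun_prop)
    (fun x m => by
      simp only [hκ, hK, Pi.add_apply]
      push_cast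
      simp only [mul_add, Finset.sum_add_distrib]
      ring)
  refine ⟨c, W, fun t => ?_⟩
  obtain ⟨x, rfl⟩ := isOpenQuotientMap_torusMk.surjective t
  rw [mFourier_torusMk, hW, ← Complex.exp_add, ← he x]
  congr 1
  ring

lemma eq_zero_of_mFourier_eq_exp {n : ℕ} {c : Fin n → ℤ} (W : C(Fin n → AddCircle (1 : ℝ), ℂ))
    (h : ∀ t, UnitAddTorus.mFourier c t = Complex.exp (W t)) : c = 0 := by
  have hπc := (isOpenQuotientMap_torusMk (n := n)).continuous
  ext j
  have := eq_zero_of_exp_mul_eq_exp_bounded (w := fun x => W (torusMk (Pi.single j x)))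
    (W.continuous.comp (hπc.comp (continuous_single (A := fun _ => ℝ) j))) (C := ‖W‖)
    (fun x => W.norm_coe_le_norm _)
    (c := c j) (fun x => by
      rw [← h, mFourier_torusMk]
      congr 1
      rw [Finset.sum_eq_single j (fun i _ hi => by simp [hi]) (by simp)]
      simp only [Pi.single_eq_same]
      push_cast
      ring)
  exact_mod_cast this

/-- A finite subset of a torsion-free abelian group generates a free subgroup; the coordinates with
respect to a basis extend to real-valued homomorphisms on the whole group. -/
lemma exists_basis_closure {A : Type*} [CommGroup A] [IsMulTorsionFree A] {S : Set A}
    (hS : S.Finite) :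
    ∃ (k : ℕ) (b : Fin k → A) (L : Additive A →+ (Fin k → ℝ)),
      (∀ i, L (Additive.ofMul (b i)) = Pi.single i 1) ∧
      (∀ a ∈ Subgroup.closure S, ∃ m : Fin k → ℤ, a = ∏ i, b i ^ m i) ∧
      ∀ i, b i ∈ Subgroup.closure S := by
  let M : Submodule ℤ (Additive A) := (Subgroup.closure S).toAddSubgroup.toIntSubmodule
  have hfg : M.FG := by
    rw [Submodule.fg_iff_addSubgroup_fg]
    exact (Subgroup.fg_iff_add_fg _).1 ⟨hS.toFinset, by simp⟩
  have : Module.Finite ℤ M := Module.Finite.iff_fg.2 hfg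
  have : Module.Free ℤ M := inferInstance
  let e := Module.finBasis ℤ M
  have hext (i) : ∃ l : Additive A →+ ℝ, ∀ x : M, l x = (e.repr x i : ℤ) := by
    obtain ⟨l, hl⟩ := (Module.Baer.of_divisible ℝ).extension_property_addMonoidHom
      M.subtype.toAddMonoidHom Subtype.val_injective
      ((Int.castAddHom ℝ).comp (e.coord i).toAddMonoidHom)
    exact ⟨l, fun x => DFunLike.congr_fun hl x⟩
  choose l hl using hext
  refine ⟨_, fun i => Additive.toMul (e i : Additive A), AddMonoidHom.pi l, fun i => ?_, ?_,
    fun i => (e i).2⟩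
  · ext j
    simp [hl, Pi.single_apply, Finsupp.single_apply, eq_comm]
  · intro a ha
    refine ⟨fun i => e.repr ⟨Additive.ofMul a, ha⟩ i, ?_⟩
    have := congrArg Subtype.val (e.sum_repr ⟨Additive.ofMul a, ha⟩)
    apply Additive.ofMul.injective
    rw [ofMul_prod]
    simpa only [ofMul_zpow, ofMul_toMul, Submodule.coe_sum, Submodule.coe_smul] using this.symm

lemma coord_eq_of_prod {A : Type*} [CommGroup A] {k : ℕ} {b : Fin k → A}
    {L : Additive A →+ (Fin k → ℝ)} (hL : ∀ i, L (Additive.ofMul (b i)) = Pi.single i 1) (m : Fin k → ℤ) :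
    L (Additive.ofMul (∏ i, b i ^ m i)) = fun i => (m i : ℝ) := by
  rw [ofMul_prod, map_sum]
  simp only [ofMul_zpow, map_zsmul, hL]
  ext i
  simp [Finset.sum_apply, Pi.single_apply]

section Dual

variable {A : Type*} [CommGroup A] [TopologicalSpace A]

lemma PontryaginDual.continuous_eval (a : A) : Continuous fun χ : PontryaginDual A => χ a :=
  (ContinuousEvalConst.continuous_eval_const (F := C(A, Circle)) a).comp
    (ContinuousMonoidHom.isInducing_toContinuousMap A Circle).continuous

lemma PontryaginDual.continuous_coe_eval (a : A) :
    Continuous fun χ : PontryaginDual A => (χ a : ℂ) :=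
  continuous_subtype_val.comp (PontryaginDual.continuous_eval a)

lemma eqOn_of_basis {k : ℕ} {b : Fin k → A} {S : Set A}
    (hb : ∀ a ∈ Subgroup.closure S, ∃ m : Fin k → ℤ, a = ∏ i, b i ^ m i) {χ ψ : PontryaginDual A}
    (h : ∀ i, χ (b i) = ψ (b i)) : EqOn χ ψ S := by
  intro a ha
  obtain ⟨m, rfl⟩ := hb a (Subgroup.subset_closure ha)
  simp [map_prod, map_zpow, h]

variable [DiscreteTopology A]

/-- The character `a ↦ exp (2πi ⟨L a, x⟩)`. -/
noncomputable def expChar {k : ℕ} (L : Additive A →+ (Fin k → ℝ)) (x : Fin k → ℝ) :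
    PontryaginDual A where
  toFun a := Circle.exp (2 * Real.pi * (L (Additive.ofMul a) ⬝ᵥ x))
  map_one' := by simp
  map_mul' a b := by rw [ofMul_mul, map_add, add_dotProduct, mul_add, Circle.exp_add]
  continuous_toFun := continuous_of_discreteTopology

lemma expChar_apply {k : ℕ} (L : Additive A →+ (Fin k → ℝ)) (x : Fin k → ℝ) (a : A) :
    expChar L x a = Circle.exp (2 * Real.pi * (L (Additive.ofMul a) ⬝ᵥ x)) := rfl

lemma expChar_zero {k : ℕ} (L : Additive A →+ (Fin k → ℝ)) : expChar L 0 = 1 := by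
  ext a
  simp [expChar_apply]

lemma continuous_expChar {k : ℕ} (L : Additive A →+ (Fin k → ℝ)) : Continuous (expChar L) := by
  refine ContinuousMonoidHom.continuous_of_continuous_uncurry (A := Fin k → ℝ) (expChar L) ?_
  refine continuous_prod_of_discrete_right.2 fun a => ?_
  exact Circle.exp.continuous.comp (continuous_const.mul
    (Continuous.dotProduct (A := fun _ => L (Additive.ofMul a)) continuous_const continuous_id))

lemma expChar_basis {k : ℕ} {b : Fin k → A} {L : Additive A →+ (Fin k → ℝ)}
    (hL : ∀ i, L (Additive.ofMul (b i)) = Pi.single i 1) (x : Fin k → ℝ) (i : Fin k) :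
    expChar L x (b i) = Circle.exp (2 * Real.pi * x i) := by
  simp [expChar_apply, hL]

/-- Continuous functions on the dual can be approximated by functions depending on the values of
the character at finitely many elements only. -/
lemma exists_finite_near (f : C(PontryaginDual A, ℂ)) {ε : ℝ} (hε : 0 < ε) :
    ∃ (S : Set A) (f' : C(PontryaginDual A, ℂ)), S.Finite ∧
      (∀ χ ψ : PontryaginDual A, EqOn χ ψ S → f' χ = f' ψ) ∧ ∀ χ, ‖f χ - f' χ‖ < ε := by
  let B : StarSubalgebra ℂ C(PontryaginDual A, ℂ) :=
    { carrier := {f | ∃ S : Set A, S.Finite ∧ ∀ χ ψ : PontryaginDual A, EqOn χ ψ S → f χ = f ψ}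
      mul_mem' := by
        rintro f g ⟨S, hS, hf⟩ ⟨T, hT, hg⟩
        exact ⟨S ∪ T, hS.union hT, fun χ ψ h => by
          simp [hf χ ψ (h.mono subset_union_left), hg χ ψ (h.mono subset_union_right)]⟩
      add_mem' := by
        rintro f g ⟨S, hS, hf⟩ ⟨T, hT, hg⟩
        exact ⟨S ∪ T, hS.union hT, fun χ ψ h => by
          simp [hf χ ψ (h.mono subset_union_left), hg χ ψ (h.mono subset_union_right)]⟩
      algebraMap_mem' := fun r => ⟨∅, finite_empty, fun χ ψ _ => by simp⟩
      star_mem' := by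
        rintro f ⟨S, hS, hf⟩
        exact ⟨S, hS, fun χ ψ h => by simp [hf χ ψ h]⟩ }
  have hB : B.topologicalClosure = ⊤ := by
    refine ContinuousMap.starSubalgebra_topologicalClosure_eq_top_of_separatesPoints B ?_
    intro χ ψ hne
    obtain ⟨a, ha⟩ := DFunLike.ne_iff.1 hne
    refine ⟨_, ⟨⟨fun χ => (χ a : ℂ), PontryaginDual.continuous_coe_eval a⟩,
      ⟨{a}, finite_singleton a, fun χ ψ h => ?_⟩, rfl⟩, ?_⟩
    · exact congrArg ((↑) : Circle → ℂ) (h rfl)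
    · exact fun h => ha (Circle.coe_injective h)
  have hf : f ∈ closure (B : Set C(PontryaginDual A, ℂ)) := by
    rw [← StarSubalgebra.topologicalClosure_coe, hB]; trivial
  obtain ⟨f', ⟨S, hS, hf'⟩, hd⟩ := Metric.mem_closure_iff.1 hf ε hε
  refine ⟨S, f', hS, hf', fun χ => ?_⟩
  rw [dist_eq_norm] at hd
  exact ((f - f').norm_coe_le_norm χ).trans_lt hd

/-- Every character agrees with one of the form `expChar L x` on a given basis. -/
lemma exists_expChar_eq {k : ℕ} {b : Fin k → A} {L : Additive A →+ (Fin k → ℝ)}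
    (hL : ∀ i, L (Additive.ofMul (b i)) = Pi.single i 1) (χ : PontryaginDual A) :
    ∃ x, ∀ i, χ (b i) = expChar L x (b i) := by
  refine ⟨fun i => Complex.arg (χ (b i)) / (2 * Real.pi), fun i => ?_⟩
  rw [expChar_basis hL, mul_div_cancel₀ _ (by positivity), Circle.exp_arg]

/-- A continuous function on the dual with exponential `1` and vanishing at the trivial character
is zero. -/
lemma eq_zero_of_exp_eq_one [IsMulTorsionFree A] (d : C(PontryaginDual A, ℂ))
    (hd : ∀ χ, Complex.exp (d χ) = 1) (h1 : d 1 = 0) (χ : PontryaginDual A) : d χ = 0 := by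
  obtain ⟨S, f', hS, hf', hd'⟩ := exists_finite_near d one_pos
  obtain ⟨k, b, L, hL, hb, -⟩ := exists_basis_closure hS
  obtain ⟨x, hx⟩ := exists_expChar_eq hL χ
  have h0 : (fun x => d (expChar L x)) = fun _ => 0 :=
    eq_of_exp_comp_eq (d.continuous.comp (continuous_expChar L)) continuous_const
      (fun x => by rw [hd, Complex.exp_zero]) 0 (by rw [expChar_zero, h1])
  have h2 := hd' χ
  rw [hf' χ _ (eqOn_of_basis hb hx)] at h2
  have h3 := hd' (expChar L x)
  rw [congrFun h0 x, zero_sub, norm_neg] at h3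
  have h4 : ‖d χ‖ < 2 := by
    have := norm_le_norm_sub_add (d χ) (f' (expChar L x))
    linarith
  obtain ⟨m, hm⟩ := Complex.exp_eq_one_iff.1 (hd χ)
  have h5 : ‖d χ‖ = |(m : ℝ)| * (2 * Real.pi) := by
    rw [hm]; simp [abs_of_pos Real.pi_pos]
  rcases eq_or_ne m 0 with rfl | h0
  · simp [hm]
  · have : (1 : ℝ) ≤ |(m : ℝ)| := by exact_mod_cast Int.one_le_abs h0
    nlinarith [Real.pi_gt_three]

/-- The only evaluation function on the dual which has a continuous logarithm is the trivial one. -/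
lemma eq_one_of_eval_eq_exp [IsMulTorsionFree A] {a : A} (w : C(PontryaginDual A, ℂ))
    (h : ∀ χ : PontryaginDual A, (χ a : ℂ) = Complex.exp (w χ)) : a = 1 := by
  obtain ⟨k, b, L, hL, hb, -⟩ := exists_basis_closure (finite_singleton a)
  obtain ⟨m, hm⟩ := hb a (Subgroup.mem_closure_singleton_self a)
  have hLa : L (Additive.ofMul a) = fun i => (m i : ℝ) := by rw [hm, coord_eq_of_prod hL]
  have hm0 (i : Fin k) : m i = 0 := by
    have := eq_zero_of_exp_mul_eq_exp_bounded (w := fun x => w (expChar L (Pi.single i x)))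
      (c := m i) (C := ‖w‖)
      (w.continuous.comp ((continuous_expChar L).comp (continuous_const.update i continuous_id)))
      (fun x => w.norm_coe_le_norm _) (fun x => ?_)
    · exact_mod_cast this
    · rw [← h, expChar_apply, hLa, Circle.coe_exp]
      congr 1
      simp
      ring
  rw [hm]
  simp [hm0]

/-- The projection of the dual to a torus given by finitely many elements. -/
noncomputable def torusProj {k : ℕ} (b : Fin k → A) :
    C(PontryaginDual A, Fin k → AddCircle (1 : ℝ)) where
  toFun χ i := (AddCircle.homeomorphCircle one_ne_zero).symm (χ (b i))
  continuous_toFun := continuous_pi fun i => (Homeomorph.continuous _).comp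
    (PontryaginDual.continuous_eval (b i))

lemma torusProj_expChar {k : ℕ} {b : Fin k → A} {L : Additive A →+ (Fin k → ℝ)}
    (hL : ∀ i, L (Additive.ofMul (b i)) = Pi.single i 1) (x : Fin k → ℝ) :
    torusProj b (expChar L x) = torusMk x := by
  ext i
  simp only [torusProj, ContinuousMap.coe_mk, torusMk_apply]
  rw [Homeomorph.symm_apply_eq, expChar_basis hL, AddCircle.homeomorphCircle_apply,
    AddCircle.toCircle_apply_mk, div_one]

/-- Every invertible function on the dual is the product of an evaluation function and an
exponential. -/
lemma exists_eq_eval_mul_exp [IsMulTorsionFree A] (f : C(PontryaginDual A, ℂ))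
    (hf : ∀ χ, f χ ≠ 0) :
    ∃ (a : A) (w : C(PontryaginDual A, ℂ)),
      ∀ χ : PontryaginDual A, f χ = (χ a : ℂ) * Complex.exp (w χ) := by
  obtain ⟨δ, hδ, hfδ⟩ : ∃ δ > 0, ∀ χ, δ ≤ ‖f χ‖ := by
    obtain ⟨χ₀, -, h⟩ := isCompact_univ.exists_isMinOn (univ_nonempty (α := PontryaginDual A))
      (f.continuous.norm.continuousOn)
    exact ⟨‖f χ₀‖, norm_pos_iff.2 (hf χ₀), fun χ => h (mem_univ χ)⟩
  obtain ⟨S, f', hS, hf', hd⟩ := exists_finite_near f hδ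
  obtain ⟨k, b, L, hL, hb, -⟩ := exists_basis_closure hS
  have hslit (χ) : f' χ / f χ ∈ Complex.slitPlane := by
    have : f' χ / f χ = 1 + (f' χ - f χ) / f χ := by field_simp [hf χ]; ring
    rw [this]
    refine Complex.mem_slitPlane_of_norm_lt_one ?_
    rw [norm_div, div_lt_one (norm_pos_iff.2 (hf χ)), norm_sub_rev]
    exact (hd χ).trans_le (hfδ χ)
  have hf'0 (χ) : f' χ ≠ 0 := fun h => by
    have := Complex.slitPlane_ne_zero (hslit χ)
    simp [h] at this
  have hper (x : Fin k → ℝ) (m : Fin k → ℤ) :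
      f' (expChar L (x + fun i => (m i : ℝ))) = f' (expChar L x) := by
    refine hf' _ _ (eqOn_of_basis hb fun i => ?_)
    rw [expChar_basis hL, expChar_basis hL, Pi.add_apply, mul_add, mul_comm _ (m i : ℝ)]
    exact Circle.periodic_exp.int_mul (m i) _
  obtain ⟨F, hF⟩ := exists_comp_torusMk_eq (w := fun x => f' (expChar L x))
    (f'.continuous.comp (continuous_expChar L)) hper
  obtain ⟨c, W, hW⟩ := exists_eq_mFourier_mul_exp F fun t => by
    obtain ⟨x, rfl⟩ := isOpenQuotientMap_torusMk.surjective t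
    rw [hF]
    exact hf'0 _
  have hlog : Continuous fun χ => Complex.log (f' χ / f χ) :=
    (f'.continuous.div f.continuous hf).clog hslit
  refine ⟨∏ i, b i ^ c i, W.comp (torusProj b) - ⟨_, hlog⟩, fun χ => ?_⟩
  obtain ⟨x, hx⟩ := exists_expChar_eq hL χ
  have hproj : torusProj b χ = torusMk x := by
    rw [← torusProj_expChar hL]
    ext i
    simp only [torusProj, ContinuousMap.coe_mk, hx]
  have hfx : f' χ = UnitAddTorus.mFourier c (torusMk x) * Complex.exp (W (torusMk x)) := by
    rw [hf' χ _ (eqOn_of_basis hb hx), ← hF, hW]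
  have hev : ((χ (∏ i, b i ^ c i) : Circle) : ℂ) = UnitAddTorus.mFourier c (torusMk x) := by
    rw [mFourier_torusMk, map_prod]
    simp only [map_zpow, hx, expChar_basis hL]
    rw [Finset.mul_sum, Complex.exp_sum]
    refine (map_prod Circle.coeHom _ _).trans (Finset.prod_congr rfl fun i _ => ?_)
    refine (Circle.coe_zpow _ _).trans ?_
    rw [Circle.coe_exp, ← Complex.exp_int_mul]
    congr 1
    push_cast
    ring
  have hexp := Complex.exp_log (Complex.slitPlane_ne_zero (hslit χ))
  simp only [ContinuousMap.sub_apply, ContinuousMap.comp_apply, ContinuousMap.coe_mk, hproj]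
  rw [Complex.exp_sub, hexp, hev, ← mul_div_assoc, ← hfx]
  field_simp [hf χ, hf'0 χ]

end Dual

/-- A star-homomorphism between algebras of continuous functions is the composition with a
continuous map. -/
lemma exists_eq_comp_of_starAlgHom {X Y : Type*} [TopologicalSpace X] [CompactSpace X]
    [TopologicalSpace Y] [CompactSpace Y] [T2Space Y] (ψ : C(Y, ℂ) →⋆ₐ[ℂ] C(X, ℂ)) :
    ∃ β : C(X, Y), ∀ F x, ψ F x = F (β x) := by
  let e := WeakDual.CharacterSpace.homeoEval Y ℂ
  let γ : C(X, WeakDual.characterSpace ℂ C(Y, ℂ)) :=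
    (WeakDual.CharacterSpace.compContinuousMap ψ).comp
      (WeakDual.CharacterSpace.continuousMapEval X ℂ)
  refine ⟨(e.symm : C(_, Y)).comp γ, fun F x => ?_⟩
  have h : e (e.symm (γ x)) = γ x := e.apply_symm_apply _
  exact (DFunLike.congr_fun h F).symm

section Action

variable {A G : Type*} [CommGroup A] [TopologicalSpace A] [DiscreteTopology A] [Group G]

/-- The action on the Pontryagin dual induced by an action by automorphisms. -/
noncomputable def dualAct (ρ : G →* (A ≃* A)) (g : G) : PontryaginDual A →ₜ* PontryaginDual A :=
  PontryaginDual.map ⟨(ρ g⁻¹ : A ≃* A), continuous_of_discreteTopology⟩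

lemma dualAct_apply (ρ : G →* (A ≃* A)) (g : G) (χ : PontryaginDual A) (a : A) :
    dualAct ρ g χ a = χ (ρ g⁻¹ a) := rfl

/-- The conditions characterizing `β` as the projection to the orbit space, in terms of
continuous functions. -/
structure IsOrbitMap (ρ : G →* (A ≃* A)) {T : Type*} [TopologicalSpace T]
    (β : C(PontryaginDual A, T)) : Prop where
  apply_dualAct : ∀ g χ, β (dualAct ρ g χ) = β χ
  exists_eq_comp : ∀ f : C(PontryaginDual A, ℂ), (∀ g χ, f (dualAct ρ g χ) = f χ) →
    ∃ F : C(T, ℂ), ∀ χ, f χ = F (β χ)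
  eq_of_comp_eq : ∀ F F' : C(T, ℂ), (∀ χ, F (β χ) = F' (β χ)) → F = F'

lemma exists_isOrbitMap (ρ : G →* (A ≃* A)) {T : Type*} [TopologicalSpace T] [CompactSpace T]
    [T2Space T]
    (Φ : fixedFunctions (fun g χ => dualAct ρ g χ) ≃⋆ₐ[ℂ] C(T, ℂ)) :
    ∃ β : C(PontryaginDual A, T), IsOrbitMap ρ β := by
  obtain ⟨β, hβ⟩ := exists_eq_comp_of_starAlgHom
    ((fixedFunctions (fun g χ => dualAct ρ g χ)).subtype.comp (Φ.symm : C(T, ℂ) →⋆ₐ[ℂ] _))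
  have hβ' (F : C(T, ℂ)) (χ) : (Φ.symm F : C(PontryaginDual A, ℂ)) χ = F (β χ) := hβ F χ
  refine ⟨β, fun g χ => ?_, fun f hf => ⟨Φ ⟨f, hf⟩, fun χ => ?_⟩, fun F F' h => ?_⟩
  · by_contra hne
    obtain ⟨f, hf0, hf1, -⟩ := exists_continuous_zero_one_of_isClosed
      (isClosed_singleton (x := β (dualAct ρ g χ))) (isClosed_singleton (x := β χ))
      (disjoint_singleton.2 hne)
    let F : C(T, ℂ) := ⟨fun t => (f t : ℂ), by fun_prop⟩
    have h1 : F (β (dualAct ρ g χ)) = F (β χ) := by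
      rw [← hβ', ← hβ']
      exact (Φ.symm F).2 g χ
    have h2 : f (β (dualAct ρ g χ)) = f (β χ) := Complex.ofReal_injective h1
    rw [hf0 rfl, hf1 rfl] at h2
    simp at h2
  · rw [← hβ', StarAlgEquiv.symm_apply_apply]
  · refine Φ.symm.injective (Subtype.ext (ContinuousMap.ext fun χ => ?_))
    exact (hβ' F χ).trans ((h χ).trans (hβ' F' χ).symm)

/-- The orbit map separates the orbits of the action on characters restricted to a finite stable
set. -/
lemma IsOrbitMap.exists_apply_eq {ρ : G →* (A ≃* A)} {T : Type*} [TopologicalSpace T]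
    {β : C(PontryaginDual A, T)} (hβ : IsOrbitMap ρ β) {S : Set A} (hS : S.Finite)
    (hstab : ∀ g, ∀ a ∈ S, ρ g a ∈ S) {χ ψ : PontryaginDual A} (h : β χ = β ψ) :
    ∃ g, ∀ a ∈ S, ψ (ρ g a) = χ a := by
  have hstab' (g : G) (a : A) : a ∈ S ↔ (ρ g).toEquiv a ∈ S := by
    refine ⟨hstab g a, fun ha => ?_⟩
    simpa [map_inv] using hstab g⁻¹ _ ha
  let τ : G →* Equiv.Perm S :=
    { toFun := fun g => (ρ g).toEquiv.subtypeEquiv (hstab' g)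
      map_one' := by ext; simp
      map_mul' := fun g g' => by ext; simp }
  have hτ (g : G) (a : S) : (τ g a : A) = ρ g a := rfl
  have := hS.fintype
  have : Fintype τ.range := Fintype.ofFinite _
  let f : C(PontryaginDual A, ℂ) :=
    { toFun := fun ψ => ∏ σ : τ.range, ((∑ a : S, ‖(ψ ((σ : Equiv.Perm S) a) - χ a : ℂ)‖ : ℝ) : ℂ)
      continuous_toFun := by
        refine continuous_finsetProd _ fun σ _ => Complex.continuous_ofReal.comp
          (continuous_finsetSum _ fun a _ => ?_)
        exact ((PontryaginDual.continuous_coe_eval _).sub continuous_const).norm }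
  have hinv (g : G) (ψ : PontryaginDual A) : f (dualAct ρ g ψ) = f ψ := by
    refine Fintype.prod_equiv (Equiv.mulLeft (⟨τ g⁻¹, g⁻¹, rfl⟩ : τ.range)) _ _ fun σ => ?_
    rfl
  obtain ⟨F, hF⟩ := hβ.exists_eq_comp f hinv
  have h0 : f χ = 0 := Finset.prod_eq_zero (Finset.mem_univ 1) (by simp)
  have h1 : f ψ = 0 := by rw [hF, ← h, ← hF, h0]
  obtain ⟨⟨_, g, rfl⟩, -, hg⟩ := Finset.prod_eq_zero_iff.1 h1
  rw [Complex.ofReal_eq_zero, Finset.sum_eq_zero_iff_of_nonneg fun _ _ => norm_nonneg _] at hg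
  refine ⟨g, fun a ha => ?_⟩
  have := hg ⟨a, ha⟩ (Finset.mem_univ _)
  rw [norm_eq_zero, sub_eq_zero] at this
  exact Circle.coe_injective this

/-- Some character of the form `expChar L x` is injective on a given finite set. -/
lemma exists_injOn_expChar {k : ℕ} {b : Fin k → A} {L : Additive A →+ (Fin k → ℝ)}
    (hL : ∀ i, L (Additive.ofMul (b i)) = Pi.single i 1) {S : Set A} (hS : S.Finite)
    (hb : ∀ a ∈ Subgroup.closure S, ∃ m : Fin k → ℤ, a = ∏ i, b i ^ m i) :
    ∃ x, InjOn (expChar L x) S := by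
  have hLinj : InjOn (fun a => L (Additive.ofMul a)) S := by
    intro a ha a' ha' h
    obtain ⟨m, rfl⟩ := hb a (Subgroup.subset_closure ha)
    obtain ⟨m', rfl⟩ := hb a' (Subgroup.subset_closure ha')
    simp only [coord_eq_of_prod hL] at h
    have : m = m' := funext fun i => by exact_mod_cast congrFun h i
    rw [this]
  have := hS.to_subtype
  obtain ⟨x, hx⟩ := Module.Dual.exists_forall_ne_zero_of_forall_exists (K := ℝ)
    (fun p : {p : S × S // p.1 ≠ p.2} => dotProductBilin ℝ ℝ
      (L (Additive.ofMul (p.1.1 : A)) - L (Additive.ofMul (p.1.2 : A)))) (fun p => by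
        by_contra! h
        refine p.2 (Subtype.ext (hLinj p.1.1.2 p.1.2.2 ?_))
        exact sub_eq_zero.1 (dotProduct_eq_zero _ h))
  have hsmall (p : {p : S × S // p.1 ≠ p.2}) : ∀ᶠ t : ℝ in 𝓝[>] 0,
      |t * ((L (Additive.ofMul (p.1.1 : A)) - L (Additive.ofMul (p.1.2 : A))) ⬝ᵥ x)| < 1 := by
    refine Filter.Eventually.filter_mono nhdsWithin_le_nhds ?_
    refine ContinuousAt.eventually_lt (by fun_prop) continuousAt_const (by simp)
  obtain ⟨t, ht, ht0⟩ := ((Filter.eventually_all.2 hsmall).and self_mem_nhdsWithin).exists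
  refine ⟨t • x, fun a ha a' ha' h => ?_⟩
  by_contra hne
  let p : {p : S × S // p.1 ≠ p.2} := ⟨(⟨a, ha⟩, ⟨a', ha'⟩), fun h => hne (congrArg Subtype.val h)⟩
  rw [expChar_apply, expChar_apply, Circle.exp_eq_exp] at h
  obtain ⟨m, hm⟩ := h
  have hm' : t * ((L (Additive.ofMul a) - L (Additive.ofMul a')) ⬝ᵥ x) = m := by
    have h2 : (2 * Real.pi) ≠ 0 := by positivity
    apply mul_left_cancel₀ h2
    rw [sub_dotProduct, mul_sub, mul_sub]
    simp only [dotProduct_smul, smul_eq_mul] at hm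
    linarith
  have h1 := ht p
  have h2 : t * ((L (Additive.ofMul a) - L (Additive.ofMul a')) ⬝ᵥ x) ≠ 0 :=
    mul_ne_zero ht0.ne' (hx p)
  simp only [p] at h1
  rw [hm'] at h1 h2
  have h3 : |m| < 1 := by exact_mod_cast h1
  rw [Int.abs_lt_one_iff] at h3
  simp [h3] at h2

/-- A finite stable set generates a group of rank at most the dimension of the orbit space. -/
lemma IsOrbitMap.rank_le {ρ : G →* (A ≃* A)} {n : ℕ}
    {β : C(PontryaginDual A, Fin n → AddCircle (1 : ℝ))} (hβ : IsOrbitMap ρ β) {S : Set A}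
    (hS : S.Finite) (hstab : ∀ g, ∀ a ∈ S, ρ g a ∈ S)
    {k : ℕ} {b : Fin k → A} {L : Additive A →+ (Fin k → ℝ)}
    (hL : ∀ i, L (Additive.ofMul (b i)) = Pi.single i 1)
    (hb : ∀ a ∈ Subgroup.closure S, ∃ m : Fin k → ℤ, a = ∏ i, b i ^ m i)
    (hbS : ∀ i, b i ∈ Subgroup.closure S) : k ≤ n := by
  obtain ⟨x₀, hx₀⟩ := exists_injOn_expChar hL hS hb
  have hev : ∀ᶠ p in 𝓝 (x₀, x₀), (∀ a ∈ S, ∀ a' ∈ S, a ≠ a' →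
      expChar L p.1 a ≠ expChar L p.2 a') ∧ dist p.1 p.2 < 1 := by
    have hcont (a : A) : Continuous fun x => expChar L x a :=
      (PontryaginDual.continuous_eval a).comp (continuous_expChar L)
    refine Filter.Eventually.and ?_ ?_
    · refine (Filter.eventually_all_finite hS).2 fun a ha =>
        (Filter.eventually_all_finite hS).2 fun a' ha' => Filter.eventually_imp_distrib_left.2
        fun hne => ?_
      exact (isOpen_ne_fun ((hcont a).comp continuous_fst)
        ((hcont a').comp continuous_snd)).mem_nhds (fun h => hne (hx₀ ha ha' h))
    · exact ContinuousAt.eventually_lt (by fun_prop) continuousAt_const (by simp)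
  rw [nhds_prod_eq, (Metric.nhds_basis_closedBall.prod_self).eventually_iff] at hev
  obtain ⟨r, hr, hball⟩ := hev
  refine le_of_continuous_injOn_closedBall_torus (j := fun x => β (expChar L (x₀ + x)))
    (β.continuous.comp ((continuous_expChar L).comp (by fun_prop))) hr fun x hx y hy hxy => ?_
  obtain ⟨g, hg⟩ := hβ.exists_apply_eq hS hstab hxy
  obtain ⟨hne, hdist⟩ := @hball (x₀ + y, x₀ + x) ⟨by simpa using hy, by simpa using hx⟩
  have hfix (a : A) (ha : a ∈ S) : ρ g a = a := by
    by_contra h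
    exact hne _ (hstab g a ha) a ha h (hg a ha)
  have heq : EqOn (expChar L (x₀ + y)) (expChar L (x₀ + x)) (Subgroup.closure S) :=
    MonoidHom.eqOn_closure (f := (expChar L (x₀ + y) : A →* Circle))
      (g := (expChar L (x₀ + x) : A →* Circle)) fun a ha => by
        have := hg a ha
        rwa [hfix a ha] at this
  ext i
  have h1 := heq (hbS i)
  rw [expChar_basis hL, expChar_basis hL, Circle.exp_eq_exp] at h1
  obtain ⟨m, hm⟩ := h1
  have h2 : y i - x i = m := by
    have h3 : (2 * Real.pi) ≠ 0 := by positivity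
    apply mul_left_cancel₀ h3
    simp only [Pi.add_apply] at hm
    linarith
  have h3 : |(m : ℝ)| < 1 := by
    rw [← h2, ← Real.dist_eq]
    simpa using (dist_le_pi_dist (x₀ + y) (x₀ + x) i).trans_lt hdist
  have h4 : |m| < 1 := by exact_mod_cast h3
  rw [Int.abs_lt_one_iff] at h4
  rw [h4, Int.cast_zero] at h2
  linarith

/-- The winding number of an invertible function on the dual is well defined. -/
lemma eq_of_eval_mul_exp_eq [IsMulTorsionFree A] {a a' : A} (w w' : C(PontryaginDual A, ℂ))
    (h : ∀ χ : PontryaginDual A,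
      (χ a : ℂ) * Complex.exp (w χ) = (χ a' : ℂ) * Complex.exp (w' χ)) : a = a' := by
  rw [← div_eq_one]
  refine eq_one_of_eval_eq_exp (w' - w) fun χ => ?_
  rw [map_div, Circle.coe_div, ContinuousMap.sub_apply, Complex.exp_sub,
    div_eq_div_iff (Circle.coe_ne_zero _) (Complex.exp_ne_zero _), h χ, mul_comm]

/-- Invertible functions on the orbit space have a winding number in `A`; this identifies `ℤⁿ` with
the fixed points of the action. -/
lemma IsOrbitMap.exists_hom_range_eq_fixed [IsMulTorsionFree A] {ρ : G →* (A ≃* A)} {n : ℕ}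
    {β : C(PontryaginDual A, Fin n → AddCircle (1 : ℝ))} (hβ : IsOrbitMap ρ β) :
    ∃ φ : Multiplicative (Fin n → ℤ) →* A, Function.Injective φ ∧
      ∀ a : A, a ∈ range φ ↔ ∀ g, ρ g a = a := by
  choose φ w hφ using fun c : Fin n → ℤ =>
    exists_eq_eval_mul_exp ((UnitAddTorus.mFourier c).comp β) fun χ => by
      obtain ⟨x, hx⟩ := isOpenQuotientMap_torusMk.surjective (β χ)
      rw [ContinuousMap.comp_apply, ← hx, mFourier_torusMk]
      exact Complex.exp_ne_zero _
  simp only [ContinuousMap.comp_apply] at hφ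
  let dualMap (g : G) : C(PontryaginDual A, PontryaginDual A) := dualAct ρ g
  have hadd (c c') : φ (c + c') = φ c * φ c' := by
    refine eq_of_eval_mul_exp_eq (w (c + c')) (w c + w c') fun χ => ?_
    rw [← hφ, UnitAddTorus.mFourier_add, hφ, hφ, map_mul, Circle.coe_mul, ContinuousMap.add_apply,
      Complex.exp_add]
    ring
  refine ⟨MonoidHom.mk' (fun c => φ c.toAdd) fun _ _ => hadd _ _, ?_,
    fun a => ⟨?_, fun ha => ?_⟩⟩
  · refine (injective_iff_map_eq_one _).2 fun c hc1 => ?_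
    induction c with | ofAdd c => ?_
    rw [MonoidHom.mk'_apply, toAdd_ofAdd] at hc1
    rw [ofAdd_eq_one]
    have hexp (χ) : UnitAddTorus.mFourier c (β χ) = Complex.exp (w c χ) := by
      rw [hφ, hc1, map_one, Circle.coe_one, one_mul]
    have hinv (g : G) (χ : PontryaginDual A) : w c (dualAct ρ g χ) = w c χ := by
      refine sub_eq_zero.1 (eq_zero_of_exp_eq_one ((w c).comp (dualMap g) - w c) (fun χ => ?_) ?_ χ)
      · change Complex.exp (w c (dualAct ρ g χ) - w c χ) = 1
        rw [Complex.exp_sub, ← hexp, ← hexp, hβ.apply_dualAct, hexp,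
          div_self (Complex.exp_ne_zero _)]
      · change w c (dualAct ρ g 1) - w c 1 = 0
        rw [map_one, sub_self]
    obtain ⟨W, hW⟩ := hβ.exists_eq_comp (w c) hinv
    refine eq_zero_of_mFourier_eq_exp W (DFunLike.congr_fun (hβ.eq_of_comp_eq _
      ⟨fun t => Complex.exp (W t), by fun_prop⟩ fun χ => ?_))
    exact (hexp χ).trans (congrArg Complex.exp (hW χ))
  · rintro ⟨c, rfl⟩ g
    induction c with | ofAdd c => ?_
    rw [MonoidHom.mk'_apply, toAdd_ofAdd]
    refine eq_of_eval_mul_exp_eq ((w c).comp (dualMap g⁻¹)) (w c) fun χ => ?_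
    rw [← hφ, ← hβ.apply_dualAct g⁻¹ χ, hφ, dualAct_apply, inv_inv]
    rfl
  · obtain ⟨F, hF⟩ := hβ.exists_eq_comp ⟨_, PontryaginDual.continuous_coe_eval a⟩ fun g χ =>
      congrArg (fun b => ((χ b : Circle) : ℂ)) (ha g⁻¹)
    obtain ⟨F', hF'⟩ := hβ.exists_eq_comp ⟨_, PontryaginDual.continuous_coe_eval a⁻¹⟩ fun g χ =>
      congrArg (fun b => ((χ b : Circle) : ℂ)) ((map_inv (ρ g⁻¹) a).trans (congrArg _ (ha g⁻¹)))
    have hone : F * F' = 1 := hβ.eq_of_comp_eq _ _ fun χ => by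
      rw [ContinuousMap.mul_apply, ← hF, ← hF', ContinuousMap.coe_mk, ContinuousMap.coe_mk,
        ← Circle.coe_mul, ← map_mul, mul_inv_cancel, map_one]
      rfl
    obtain ⟨c, W, hW⟩ := exists_eq_mFourier_mul_exp F fun t h0 => by
      have := DFunLike.congr_fun hone t
      simp [h0] at this
    refine ⟨.ofAdd c, eq_of_eval_mul_exp_eq (w c + W.comp β) 0 fun χ => ?_⟩
    have h1 := hF χ
    rw [ContinuousMap.coe_mk, hW, hφ] at h1
    rw [h1]
    simp [Complex.exp_add, mul_assoc]

end Action

/-- Let `A` be a torsion-free abelian group and `G` a group acting on `A` by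
automorphisms (via `ρ : G →* (A ≃* A)`) with finite orbits.  `G` acts on the Pontryagin
dual `Â` by `χ ↦ χ ∘ ρ g⁻¹`.  If the fixed-point algebra `C(Â)^G ⊆ C(Â, ℂ)` is
star-isomorphic to `C(T^n, ℂ)` for some `n`, then `A ≅ ℤ^n` and `G` acts trivially
on `A`. -/
theorem stmt_2 {A G : Type*} [CommGroup A] [TopologicalSpace A] [DiscreteTopology A]
    [Group G] (htf : ∀ a : A, IsOfFinOrder a → a = 1)
    (ρ : G →* (A ≃* A)) (hfin : ∀ a : A, (Set.range fun g : G => ρ g a).Finite)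
    (n : ℕ)
    (h : Nonempty
      ((fixedFunctions fun (g : G) (χ : PontryaginDual A) =>
          χ.comp ⟨(ρ g⁻¹ : A ≃* A), continuous_of_discreteTopology⟩) ≃⋆ₐ[ℂ]
        C((Fin n → AddCircle (1 : ℝ)), ℂ))) :
    Nonempty (A ≃* Multiplicative (Fin n → ℤ)) ∧ ∀ (g : G) (a : A), ρ g a = a := by
  have : IsMulTorsionFree A :=
    IsMulTorsionFree.of_not_isOfFinOrder fun a ha hfo => ha (htf a hfo)
  obtain ⟨Φ⟩ := h
  obtain ⟨β, hβ⟩ := exists_isOrbitMap ρ Φ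
  obtain ⟨φ, hφinj, hφ⟩ := hβ.exists_hom_range_eq_fixed
  have htriv (a : A) (g : G) : ρ g a = a := by
    let u : Fin (n + 1) → A :=
      Fin.cons a fun i : Fin n => φ (.ofAdd (Pi.single i 1))
    let S : Set A := (range fun g => ρ g a) ∪
      range fun i : Fin n => φ (.ofAdd (Pi.single i 1))
    have hS : S.Finite := (hfin a).union (finite_range _)
    have hstab (g : G) : ∀ b ∈ S, ρ g b ∈ S := by
      rintro _ (⟨g', rfl⟩ | ⟨i, rfl⟩)
      · exact Or.inl ⟨g * g', by simp⟩
      · exact Or.inr ⟨i, ((hφ _).1 ⟨_, rfl⟩ g).symm⟩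
    have huS (i) : u i ∈ S := by
      refine Fin.cases ?_ (fun i => ?_) i
      · exact Or.inl ⟨1, by simp [u]⟩
      · exact Or.inr ⟨i, rfl⟩
    obtain ⟨k, b, L, hL, hb, hbS⟩ := exists_basis_closure hS
    have hkn := hβ.rank_le hS hstab hL hb hbS
    choose v hv using fun i => hb (u i) (Subgroup.subset_closure (huS i))
    have hdep : ¬ LinearIndependent ℤ v := fun hli => by
      have := hli.fintype_card_le_finrank
      simp at this
      omega
    obtain ⟨c, hc, hc0⟩ := Fintype.not_linearIndependent_iff.1 hdep
    have hprod : ∏ i, u i ^ c i = 1 := by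
      apply Additive.ofMul.injective
      simp only [hv, ofMul_prod, ofMul_zpow, Finset.smul_sum, smul_smul, ofMul_one]
      rw [Finset.sum_comm]
      refine Finset.sum_eq_zero fun j _ => ?_
      have hj : ∑ i, c i * v i j = 0 := by simpa using congrFun hc j
      rw [← Finset.sum_smul, hj, zero_smul]
    have htail : ∏ i : Fin n, φ (.ofAdd (Pi.single i 1)) ^ c i.succ =
        φ (.ofAdd (Fin.tail c)) := by
      rw [pi_eq_sum_univ' (Fin.tail c), ofAdd_sum, map_prod]
      simp only [ofAdd_zsmul, map_zpow, Fin.tail]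
    rw [Fin.prod_univ_succ] at hprod
    simp only [u, Fin.cons_zero, Fin.cons_succ] at hprod
    rw [htail] at hprod
    have hc00 : c 0 ≠ 0 := by
      intro h0
      rw [h0, zpow_zero, one_mul] at hprod
      have h1 : Fin.tail c = 0 := ofAdd_eq_one.1 ((injective_iff_map_eq_one φ).1 hφinj _ hprod)
      obtain ⟨i, hi⟩ := hc0
      refine hi ?_
      refine Fin.cases h0 (fun i => congrFun h1 i) i
    have hfix := (hφ (a ^ c 0)).1 ⟨(.ofAdd (Fin.tail c))⁻¹, by
      rw [map_inv, eq_inv_of_mul_eq_one_left hprod]⟩ g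
    rw [map_zpow] at hfix
    exact zpow_left_injective hc00 hfix
  refine ⟨⟨?_⟩, fun g a => htriv a g⟩
  have hbij : Function.Bijective φ := ⟨hφinj, fun a => (hφ a).2 (htriv a)⟩
  exact (MulEquiv.ofBijective φ hbij).symm
end

section
/- Let G be a torsion-free group whose centre Z(G) has finite index in G. Then G is abelian. -/
/-- **A torsion-free group whose centre has finite index is abelian.** -/
theorem stmt_17 {G : Type*} [Group G] (htf : ∀ g : G, IsOfFinOrder g → g = 1)
    (hfi : (Subgroup.center G).FiniteIndex) :
    ∀ a b : G, a * b = b * a := by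
  intro a b
  rw [← commutatorElement_eq_one_iff_mul_comm]
  refine htf _ (isOfFinOrder_iff_pow_eq_one.mpr
    ⟨(Subgroup.center G).index, Nat.pos_of_ne_zero hfi.index_ne_zero, ?_⟩)
  rw [← MonoidHom.transferCenterPow_apply, map_commutatorElement,
    commutatorElement_eq_one_iff_mul_comm.mpr (mul_comm' _ _), Subgroup.coe_one]
end
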